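/- Let (W,S) be a finite Coxeter system and I,J ⊆ S with I ∼_W J. Then Φ(x_I)(x_J) = Φ(x_J)(x_I); equivalently, Σ_{w ∈ X_J} 1_{W_I}^W(w) = Σ_{w ∈ X_I} 1_{W_J}^W(w). -/

import Mathlib

open scoped Classical

variable {B : Type*} {W : Type*} [Group W] {M : CoxeterMatrix B}

/-- The parabolic subgroup `W_I` generated by the simple reflections indexed by `I`. -/
def parabolic (cs : CoxeterSystem M W) (I : Set B) : Subgroup W :=
  Subgroup.closure (cs.simple '' I)

/-- `X_I`: minimal length coset representatives of `W / W_I`. -/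
def minReps (cs : CoxeterSystem M W) (I : Set B) : Set W :=
  {w : W | ∀ i ∈ I, cs.length w < cs.length (w * cs.simple i)}

/-- `I ∼_W J`: the subsets of simple reflections are conjugate under `W`. -/
def ConjSubsets (cs : CoxeterSystem M W) (I J : Set B) : Prop :=
  ∃ w : W, (fun x => w * x * w⁻¹) '' (cs.simple '' I) = cs.simple '' J

theorem conjSubsets_equivalence (cs : CoxeterSystem M W) : Equivalence (ConjSubsets cs) where
  refl I := ⟨1, by simp⟩
  symm := by
    rintro I J ⟨w, h⟩
    refine ⟨w⁻¹, ?_⟩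
    rw [← h, Set.image_image]
    simp [mul_assoc]
  trans := by
    rintro I J K ⟨w, h⟩ ⟨v, h'⟩
    refine ⟨v * w, ?_⟩
    rw [← h', ← h]
    simp [Set.image_image, mul_assoc]

/-- The setoid of Coxeter classes. -/
def coxSetoid (cs : CoxeterSystem M W) : Setoid (Set B) :=
  ⟨ConjSubsets cs, conjSubsets_equivalence cs⟩

/-- The set of Coxeter classes `Λ(W)`. -/
def CoxeterClass (cs : CoxeterSystem M W) := Quotient (coxSetoid cs)

/-- `C` is a conjugacy class of the parabolic subgroup `W_I`. -/
def IsConjClassOfParabolic (cs : CoxeterSystem M W) (I : Set B) (C : Set W) : Prop :=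
  ∃ v ∈ parabolic cs I, C = {x : W | ∃ u ∈ parabolic cs I, u * v * u⁻¹ = x}

/-- `C` is an `I`-cuspidal class: a conjugacy class of `W_I` meeting no proper
parabolic subgroup of `W_I`. -/
def IsCuspidalClass (cs : CoxeterSystem M W) (I : Set B) (C : Set W) : Prop :=
  IsConjClassOfParabolic cs I C ∧ ∀ K : Set B, K ⊂ I → C ∩ (parabolic cs K : Set W) = ∅

/-- `w` is an `I`-element: `C(w) ∩ W_I` is an `I`-cuspidal class. -/
def IsElementOf (cs : CoxeterSystem M W) (I : Set B) (w : W) : Prop :=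
  IsCuspidalClass cs I ({x : W | IsConj w x} ∩ (parabolic cs I : Set W))

/-- The λ-set `C(λ)` of the Coxeter class of `I`: the set of `λ(I)`-elements. -/
def lambdaSet (cs : CoxeterSystem M W) (I : Set B) : Set W :=
  {w : W | ∃ J : Set B, ConjSubsets cs I J ∧ IsElementOf cs J w}

/-- The λ-set of a Coxeter class. -/
def lambdaSetQ (cs : CoxeterSystem M W) (lam : CoxeterClass cs) : Set W :=
  {w : W | ∃ I : Set B, Quotient.mk (coxSetoid cs) I = lam ∧ IsElementOf cs I w}

/-- The induced character `1_{W_I}^W` of the trivial character of `W_I`,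
as a `ℚ`-valued function on `W`. -/
noncomputable def indTriv (cs : CoxeterSystem M W) (I : Set B) : W → ℚ :=
  fun w => (Nat.card {g : W | g ∈ minReps cs I ∧ g⁻¹ * w * g ∈ parabolic cs I} : ℚ)


/-! ### The reflection cocycle -/

/-- The permutation of `W × ZMod 2` attached to `i : B`: conjugation by the simple reflection `s i`
on `W`, together with a flip of the sign over `s i` itself. -/
noncomputable def simpleFlip (cs : CoxeterSystem M W) (i : B) : Equiv.Perm (W × ZMod 2) :=
  Function.Involutive.toPerm
    (fun p => (cs.simple i * p.1 * cs.simple i, p.2 + if p.1 = cs.simple i then 1 else 0)) <| by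
    rintro ⟨t, ε⟩
    have h : cs.simple i * t * cs.simple i = cs.simple i ↔ t = cs.simple i := by
      constructor
      · intro h
        have := congrArg (fun x => cs.simple i * x * cs.simple i) h
        simpa [mul_assoc] using this
      · rintro rfl
        simp
    ext
    · simp [mul_assoc]
    · simp only [h, add_assoc]
      split_ifs
      · simp [CharTwo.add_self_eq_zero]
      · simp

theorem simpleFlip_apply (cs : CoxeterSystem M W) (i : B) (t : W) (ε : ZMod 2) :
    simpleFlip cs i (t, ε) =
      (cs.simple i * t * cs.simple i, ε + if t = cs.simple i then 1 else 0) := rfl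

theorem simple_mul_pow (cs : CoxeterSystem M W) (i j : B) (p : ℕ) :
    cs.simple j * (cs.simple i * cs.simple j) ^ p
      = ((cs.simple i * cs.simple j) ^ p)⁻¹ * cs.simple j := by
  induction p with
  | zero => simp
  | succ p ih =>
    rw [pow_succ, ← mul_assoc, ih, ← pow_succ, pow_succ']
    simp [mul_assoc]

theorem simpleFlip_mul_pow_apply (cs : CoxeterSystem M W) (i j : B) (p : ℕ) (t : W) (ε : ZMod 2) :
    ((simpleFlip cs i * simpleFlip cs j) ^ p) (t, ε) =
      ((cs.simple i * cs.simple j) ^ p * t * ((cs.simple i * cs.simple j) ^ p)⁻¹,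
        ε + ∑ k ∈ Finset.range (2 * p),
          if t = cs.simple j * (cs.simple i * cs.simple j) ^ k then 1 else 0) := by
  induction p with
  | zero => simp
  | succ p ih =>
    rw [pow_succ', Equiv.Perm.mul_apply, ih, Equiv.Perm.mul_apply, simpleFlip_apply,
      simpleFlip_apply]
    set c := cs.simple i * cs.simple j with hc
    have h1 : c ^ p * t * (c ^ p)⁻¹ = cs.simple j ↔ t = cs.simple j * c ^ (2 * p) := by
      rw [two_mul, pow_add, ← mul_assoc, simple_mul_pow, mul_inv_eq_iff_eq_mul, ← hc, mul_assoc,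
        eq_inv_mul_iff_mul_eq]
    have h2 : cs.simple j * (c ^ p * t * (c ^ p)⁻¹) * cs.simple j = cs.simple i ↔
        t = cs.simple j * c ^ (2 * p + 1) := by
      have e : cs.simple j * c ^ (2 * p + 1)
          = (c ^ p)⁻¹ * (cs.simple j * cs.simple i * cs.simple j) * c ^ p := by
        rw [two_mul, add_assoc, pow_add, ← mul_assoc, simple_mul_pow, ← hc, pow_succ', hc]
        simp only [mul_assoc]
      rw [e]
      constructor
      · intro h
        rw [← h]
        simp [mul_assoc]
      · rintro rfl
        simp [mul_assoc]
    ext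
    · simp [hc, pow_succ', mul_assoc]
    · simp only [h1, h2, mul_add, mul_one, Finset.sum_range_succ, add_assoc]

theorem isLiftable_simpleFlip (cs : CoxeterSystem M W) : M.IsLiftable (simpleFlip cs) := by
  intro i j
  ext1 ⟨t, ε⟩
  rw [simpleFlip_mul_pow_apply, two_mul, Finset.sum_range_add]
  simp [pow_add, CharTwo.add_self_eq_zero]

/-- The action of `W` on `W × ZMod 2` extending `simpleFlip`. -/
noncomputable def flipHom (cs : CoxeterSystem M W) : W →* Equiv.Perm (W × ZMod 2) :=
  cs.lift ⟨simpleFlip cs, isLiftable_simpleFlip cs⟩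

theorem flipHom_wordProd (cs : CoxeterSystem M W) (ω : List B) (t : W) (ε : ZMod 2) :
    flipHom cs (cs.wordProd ω) (t, ε) =
      (cs.wordProd ω * t * (cs.wordProd ω)⁻¹, ε + ((cs.rightInvSeq ω).count t : ZMod 2)) := by
  induction ω with
  | nil => simp
  | cons i ω ih =>
    have h : cs.wordProd ω * t * (cs.wordProd ω)⁻¹ = cs.simple i ↔
        (cs.wordProd ω)⁻¹ * cs.simple i * cs.wordProd ω = t := by
      constructor
      · intro h
        rw [← h]
        group
      · rintro rfl
        group
    rw [cs.wordProd_cons, map_mul, Equiv.Perm.mul_apply, ih, flipHom, cs.lift_apply_simple,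
      simpleFlip_apply]
    ext
    · simp [mul_assoc]
    · simp only [h, CoxeterSystem.rightInvSeq, List.count_cons, beq_iff_eq]
      split_ifs <;> push_cast <;> ring

/-- The parity of the number of occurrences of `t` among the right inversions of a word for `w`. -/
noncomputable def invParity (cs : CoxeterSystem M W) (w t : W) : ZMod 2 := (flipHom cs w (t, 0)).2

theorem invParity_wordProd (cs : CoxeterSystem M W) (ω : List B) (t : W) :
    invParity cs (cs.wordProd ω) t = ((cs.rightInvSeq ω).count t : ZMod 2) := by
  simp [invParity, flipHom_wordProd]

theorem flipHom_apply (cs : CoxeterSystem M W) (w t : W) (ε : ZMod 2) :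
    flipHom cs w (t, ε) = (w * t * w⁻¹, ε + invParity cs w t) := by
  obtain ⟨ω, -, rfl⟩ := cs.exists_isReduced w
  rw [flipHom_wordProd, invParity_wordProd]

theorem invParity_mul (cs : CoxeterSystem M W) (u w t : W) :
    invParity cs (u * w) t = invParity cs w t + invParity cs u (w * t * w⁻¹) := by
  rw [invParity, map_mul, Equiv.Perm.mul_apply, flipHom_apply, flipHom_apply, zero_add]

theorem invParity_one (cs : CoxeterSystem M W) (t : W) : invParity cs 1 t = 0 := by
  simp [invParity]

theorem invParity_simple_self (cs : CoxeterSystem M W) (i : B) :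
    invParity cs (cs.simple i) (cs.simple i) = 1 := by
  simpa using invParity_wordProd cs [i] (cs.simple i)

theorem mem_rightInvSeq_of_invParity_ne_zero (cs : CoxeterSystem M W) {ω : List B} {t : W}
    (h : invParity cs (cs.wordProd ω) t ≠ 0) : t ∈ cs.rightInvSeq ω := by
  by_contra hn
  rw [invParity_wordProd, List.count_eq_zero_of_not_mem hn] at h
  simp at h

theorem length_mul_lt_of_invParity_ne_zero (cs : CoxeterSystem M W) {w t : W}
    (h : invParity cs w t ≠ 0) : cs.length (w * t) < cs.length w := by
  obtain ⟨ω, hω, rfl⟩ := cs.exists_isReduced w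
  exact (cs.isRightInversion_of_mem_rightInvSeq hω
    (mem_rightInvSeq_of_invParity_ne_zero cs h)).2

theorem invParity_simple_eq_zero_iff (cs : CoxeterSystem M W) (w : W) (i : B) :
    invParity cs w (cs.simple i) = 0 ↔ cs.length w < cs.length (w * cs.simple i) := by
  constructor
  · intro h
    have h' : invParity cs (w * cs.simple i) (cs.simple i) ≠ 0 := by
      rw [invParity_mul, invParity_simple_self]
      simp [h]
    simpa using length_mul_lt_of_invParity_ne_zero cs h'
  · intro h
    by_contra hn
    exact (length_mul_lt_of_invParity_ne_zero cs hn).not_gt h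

theorem mem_minReps_iff (cs : CoxeterSystem M W) {K : Set B} {m : W} :
    m ∈ minReps cs K ↔ ∀ i ∈ K, invParity cs m (cs.simple i) = 0 := by
  simp only [invParity_simple_eq_zero_iff]
  rfl

/-! ### Minimal coset representatives -/

theorem exists_isReduced_of_mem_parabolic (cs : CoxeterSystem M W) {K : Set B} {u : W}
    (hu : u ∈ parabolic cs K) :
    ∃ ω : List B, (∀ i ∈ ω, i ∈ K) ∧ cs.IsReduced ω ∧ cs.wordProd ω = u := by
  have step : ∀ (x : W), ∀ i ∈ K,
      (∃ ω : List B, (∀ i ∈ ω, i ∈ K) ∧ cs.IsReduced ω ∧ cs.wordProd ω = x) →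
      ∃ ω : List B, (∀ i ∈ ω, i ∈ K) ∧ cs.IsReduced ω ∧ cs.wordProd ω = x * cs.simple i := by
    rintro _ i hi ⟨ω, hωK, hω, rfl⟩
    rcases cs.length_mul_simple (cs.wordProd ω) i with h | h
    · refine ⟨ω ++ [i], ?_, ?_, by simp [cs.wordProd_append]⟩
      · simp only [List.mem_append, List.mem_singleton]
        rintro j (hj | rfl)
        exacts [hωK j hj, hi]
      · rw [CoxeterSystem.IsReduced, cs.wordProd_append, cs.wordProd_singleton, h, hω.eq]
        simp
    · have hmem : cs.simple i ∈ cs.rightInvSeq ω := by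
        apply mem_rightInvSeq_of_invParity_ne_zero
        rw [Ne, invParity_simple_eq_zero_iff]
        omega
      obtain ⟨j, hj, hij⟩ := List.mem_iff_getElem.mp hmem
      have hprod := cs.wordProd_mul_getD_rightInvSeq ω j
      rw [List.getD_eq_getElem _ 1 hj, hij] at hprod
      refine ⟨ω.eraseIdx j, fun k hk => hωK k (List.mem_of_mem_eraseIdx hk), ?_, hprod.symm⟩
      rw [cs.length_rightInvSeq] at hj
      have := List.length_eraseIdx_add_one hj
      rw [hω.eq] at h
      rw [CoxeterSystem.IsReduced, ← hprod]
      omega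
  induction hu using Subgroup.closure_induction_right with
  | one => exact ⟨[], by simp, by simp [CoxeterSystem.IsReduced], by simp⟩
  | mul_right x _ y hy ih =>
    obtain ⟨i, hi, rfl⟩ := hy
    exact step x i hi ih
  | mul_inv_cancel x _ y hy ih =>
    obtain ⟨i, hi, rfl⟩ := hy
    simpa using step x i hi ih

theorem exists_invParity_ne_zero (cs : CoxeterSystem M W) {K : Set B} {u : W}
    (hu : u ∈ parabolic cs K) (h1 : u ≠ 1) : ∃ i ∈ K, invParity cs u (cs.simple i) ≠ 0 := by
  obtain ⟨ω, hωK, hω, rfl⟩ := exists_isReduced_of_mem_parabolic cs hu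
  rcases List.eq_nil_or_concat ω with rfl | ⟨ω, i, rfl⟩
  · simp at h1
  · refine ⟨i, hωK i (by simp), ?_⟩
    have h := hω.eq
    have hle := cs.length_wordProd_le ω
    rw [Ne, invParity_simple_eq_zero_iff]
    simp only [List.concat_eq_append, cs.wordProd_append, cs.wordProd_singleton,
      List.length_append, List.length_singleton, cs.simple_mul_simple_cancel_right] at h ⊢
    omega

theorem simple_mem_parabolic (cs : CoxeterSystem M W) {K : Set B} {i : B} (hi : i ∈ K) :
    cs.simple i ∈ parabolic cs K :=
  Subgroup.subset_closure ⟨i, hi, rfl⟩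

theorem exists_minimal_mul_mem_parabolic (cs : CoxeterSystem M W) (K : Set B) (g : W) :
    ∃ u ∈ parabolic cs K, ∀ r ∈ parabolic cs K, invParity cs (g * u) r = 0 := by
  obtain ⟨u, hu, hmin⟩ := (WellFounded.has_min (measure fun u => cs.length (g * u)).wf
    (parabolic cs K : Set W) ⟨1, one_mem _⟩)
  refine ⟨u, hu, fun r hr => ?_⟩
  by_contra h
  have := length_mul_lt_of_invParity_ne_zero cs h
  rw [mul_assoc] at this
  exact hmin _ (mul_mem hu hr) this

theorem eq_one_of_mul_mem_minReps (cs : CoxeterSystem M W) {K : Set B} {m u : W}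
    (hm : ∀ r ∈ parabolic cs K, invParity cs m r = 0) (hu : u ∈ parabolic cs K)
    (hmu : m * u ∈ minReps cs K) : u = 1 := by
  by_contra h1
  obtain ⟨i, hi, h⟩ := exists_invParity_ne_zero cs hu h1
  apply h
  have := mem_minReps_iff cs |>.mp hmu i hi
  rwa [invParity_mul, hm _ (mul_mem (mul_mem hu (simple_mem_parabolic cs hi)) (inv_mem hu)),
    add_zero] at this

theorem invParity_eq_zero_of_mem_minReps (cs : CoxeterSystem M W) {K : Set B} {m r : W}
    (hm : m ∈ minReps cs K) (hr : r ∈ parabolic cs K) : invParity cs m r = 0 := by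
  obtain ⟨u, hu, h⟩ := exists_minimal_mul_mem_parabolic cs K m
  have : u⁻¹ = 1 := eq_one_of_mul_mem_minReps cs h (inv_mem hu) (by simpa using hm)
  rw [inv_eq_one] at this
  subst this
  simpa using h r hr

theorem bijective_minReps_mul_parabolic (cs : CoxeterSystem M W) (K : Set B) :
    Function.Bijective (fun p : minReps cs K × parabolic cs K => (p.1 : W) * p.2) := by
  constructor
  · rintro ⟨⟨m, hm⟩, ⟨u, hu⟩⟩ ⟨⟨m', hm'⟩, ⟨u', hu'⟩⟩ h
    dsimp only at h
    have e : m' = m * (u * u'⁻¹) := by rw [← mul_assoc, h, mul_inv_cancel_right]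
    have h1 := eq_one_of_mul_mem_minReps cs
      (fun r hr => invParity_eq_zero_of_mem_minReps cs hm hr) (mul_mem hu (inv_mem hu')) (e ▸ hm')
    rw [h1, mul_one] at e
    rw [mul_inv_eq_one] at h1
    subst e h1
    rfl
  · intro g
    obtain ⟨u, hu, h⟩ := exists_minimal_mul_mem_parabolic cs K g
    refine ⟨⟨⟨g * u, ?_⟩, ⟨u⁻¹, inv_mem hu⟩⟩, by simp⟩
    exact mem_minReps_iff cs |>.mpr fun i hi => h _ (simple_mem_parabolic cs hi)

theorem sum_minReps_parabolic [Fintype W] (cs : CoxeterSystem M W) (K : Set B)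
    {A : Type*} [AddCommMonoid A] (F : W → A) :
    ∑ m : minReps cs K, ∑ u : parabolic cs K, F (m * u) = ∑ g : W, F g := by
  rw [← Fintype.sum_prod_type' (f := fun (m : minReps cs K) (u : parabolic cs K) => F (m * u))]
  exact (bijective_minReps_mul_parabolic cs K).sum_comp F

/-! ### Sign vectors -/

/-- Superposition of sign vectors: entries of `τ` fill the undetermined entries of `σ`. -/
def overlay {T α : Type*} (σ τ : T → Option α) : T → Option α := fun t => (σ t).or (τ t)

theorem overlay_assoc {T α : Type*} (ρ σ τ : T → Option α) :
    overlay (overlay ρ σ) τ = overlay ρ (overlay σ τ) :=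
  funext fun _ => Option.or_assoc

/-- The linear operator on formal combinations of sign vectors induced by `overlay σ`. -/
noncomputable def overlayEnd {T α : Type*} (σ : T → Option α) :
    Module.End ℚ ((T → Option α) →₀ ℚ) :=
  Finsupp.lmapDomain ℚ ℚ (overlay σ)

theorem overlayEnd_single {T α : Type*} (σ τ : T → Option α) :
    overlayEnd σ (Finsupp.single τ 1) = Finsupp.single (overlay σ τ) 1 :=
  Finsupp.mapDomain_single

theorem overlayEnd_mul {T α : Type*} (σ τ : T → Option α) :
    overlayEnd σ * overlayEnd τ = overlayEnd (overlay σ τ) := by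
  ext1 ρ
  ext1
  simp [overlayEnd_single, overlay_assoc]

theorem overlayEnd_none {T α : Type*} :
    overlayEnd (fun _ : T => (none : Option α)) = 1 := by
  ext1 ρ
  ext1
  simp only [LinearMap.comp_apply, Finsupp.lsingle_apply, overlayEnd_single]
  rfl

theorem overlayEnd_mul_pow_sum_sub_eq_zero {T α ι : Type*} [Fintype T] [Fintype ι]
    {σ σ' : ι → T → Option α} (h : ∀ i t, σ i t = none ↔ σ' i t = none) (n : ℕ)
    (τ : T → Option α) (hτ : (Finset.univ.filter fun t => τ t = none).card < n) :
    overlayEnd τ * (∑ i, (overlayEnd (σ i) - overlayEnd (σ' i))) ^ n = 0 := by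
  induction n generalizing τ with
  | zero => simp at hτ
  | succ n ih =>
    rw [pow_succ', ← mul_assoc, Finset.mul_sum, Finset.sum_mul]
    refine Finset.sum_eq_zero fun i _ => ?_
    rw [mul_sub, overlayEnd_mul, overlayEnd_mul]
    by_cases hi : ∀ t, τ t = none → σ i t = none
    · have absorb : ∀ ρ : T → Option α, (∀ t, τ t = none → ρ t = none) → overlay τ ρ = τ := by
        intro ρ hρ
        funext t
        cases ht : τ t with
        | none => simp [overlay, ht, hρ t ht]
        | some a => simp [overlay, ht]
      rw [absorb _ hi, absorb _ fun t ht => (h i t).mp (hi t ht), sub_self, zero_mul]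
    · push Not at hi
      obtain ⟨t₀, ht₀, hσ⟩ := hi
      have small : ∀ ρ : T → Option α, ρ t₀ ≠ none →
          (Finset.univ.filter fun t => overlay τ ρ t = none).card < n := by
        intro ρ hρ
        refine lt_of_lt_of_le ?_ (Nat.lt_succ_iff.mp hτ)
        refine Finset.card_lt_card (Finset.ssubset_iff_of_subset ?_ |>.mpr ⟨t₀, ?_, ?_⟩)
        · exact Finset.monotone_filter_right _ fun t _ ht => (Option.or_eq_none_iff.mp ht).1
        · simpa using ht₀
        · simpa [overlay, ht₀] using hρ
      rw [sub_mul, ih _ (small _ hσ), ih _ (small _ fun h' => hσ ((h i t₀).mpr h')), sub_zero]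

theorem isNilpotent_sum_overlayEnd_sub {T α ι : Type*} [Fintype T] [Fintype ι]
    {σ σ' : ι → T → Option α} (h : ∀ i t, σ i t = none ↔ σ' i t = none) :
    IsNilpotent (∑ i, (overlayEnd (σ i) - overlayEnd (σ' i))) :=
  ⟨_, by simpa only [overlayEnd_none, one_mul] using
    overlayEnd_mul_pow_sum_sub_eq_zero h _ (fun _ => none) (Nat.lt_succ_self _)⟩

/-! ### Sign vectors of chambers and faces -/

theorem invParity_inv_conj (cs : CoxeterSystem M W) (w t : W) :
    invParity cs w⁻¹ (w * t * w⁻¹) = invParity cs w t := by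
  have h := invParity_mul cs w⁻¹ w t
  rw [inv_mul_cancel, invParity_one] at h
  exact (CharTwo.add_eq_zero.mp h.symm).symm

theorem invParity_eq_zero_of_notMem_parabolic (cs : CoxeterSystem M W) {K : Set B} {u r : W}
    (hu : u ∈ parabolic cs K) (hr : r ∉ parabolic cs K) : invParity cs u r = 0 := by
  have conj : ∀ x ∈ parabolic cs K, ∀ r ∉ parabolic cs K, x * r * x⁻¹ ∉ parabolic cs K := by
    intro x hx r hr h
    exact hr (by simpa [mul_assoc] using mul_mem (mul_mem (inv_mem hx) h) hx)
  induction hu using Subgroup.closure_induction generalizing r with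
  | mem x hx =>
    obtain ⟨i, hi, rfl⟩ := hx
    have h : r ≠ cs.simple i := by
      rintro rfl
      exact hr (simple_mem_parabolic cs hi)
    simpa [h.symm] using invParity_wordProd cs [i] r
  | one => exact invParity_one cs r
  | mul x y _ hy ihx ihy => rw [invParity_mul, ihy hr, ihx (conj y hy r hr), add_zero]
  | inv x hx ih =>
    have h := conj x⁻¹ (inv_mem hx) r hr
    rw [← ih h, ← invParity_inv_conj cs x]
    simp [mul_assoc]

/-- The sign vector of the chamber `v`: its entry at `t` records whether `t` is a left inversion
of `v`. -/
noncomputable def chamberSign (cs : CoxeterSystem M W) (v : W) : W → Option (ZMod 2) :=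
  fun t => some (invParity cs v⁻¹ t)

/-- The sign vector of the face `g W_K`, undetermined on the stabilizer of that face. -/
noncomputable def faceSign (cs : CoxeterSystem M W) (K : Set B) (g : W) : W → Option (ZMod 2) :=
  fun t => if g⁻¹ * t * g ∈ parabolic cs K then none else some (invParity cs g⁻¹ t)

theorem faceSign_eq_none_iff (cs : CoxeterSystem M W) {K : Set B} {g t : W} :
    faceSign cs K g t = none ↔ g⁻¹ * t * g ∈ parabolic cs K := by
  simp [faceSign]

theorem chamberSign_injective (cs : CoxeterSystem M W) : Function.Injective (chamberSign cs) := by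
  intro v y h
  by_contra hne
  have h1 : y⁻¹ * v ≠ 1 := fun h' => hne (inv_mul_eq_one.mp h').symm
  obtain ⟨i, hi⟩ := cs.exists_rightDescent_of_ne_one h1
  have h2 := Option.some_injective _ (congrFun h (v * cs.simple i * v⁻¹))
  have h3 := invParity_mul cs (y⁻¹ * v) v⁻¹ (v * cs.simple i * v⁻¹)
  rw [mul_inv_cancel_right, ← h2, left_eq_add, inv_inv,
    show v⁻¹ * (v * cs.simple i * v⁻¹) * v = cs.simple i by group,
    invParity_simple_eq_zero_iff] at h3
  exact h3.not_gt hi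

theorem overlay_faceSign_chamberSign (cs : CoxeterSystem M W) {K : Set B} (v : W) {m u : W}
    (hm : m ∈ minReps cs K) (hu : u ∈ parabolic cs K) :
    overlay (faceSign cs K (v * (m * u))) (chamberSign cs v) = chamberSign cs (v * m) := by
  funext t
  set r := (v * m)⁻¹ * t * (v * m) with hr
  have hmem : (v * (m * u))⁻¹ * t * (v * (m * u)) ∈ parabolic cs K ↔ r ∈ parabolic cs K := by
    rw [show (v * (m * u))⁻¹ * t * (v * (m * u)) = u⁻¹ * r * u by rw [hr]; group,
      Subgroup.mul_mem_cancel_right _ hu, Subgroup.mul_mem_cancel_left _ (inv_mem hu)]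
  by_cases h : r ∈ parabolic cs K
  · have e : v⁻¹ * t * v⁻¹⁻¹ = m * r * m⁻¹ := by rw [hr]; group
    simp only [overlay, faceSign, chamberSign, hmem, h, if_true, Option.none_or]
    rw [mul_inv_rev, invParity_mul, e, invParity_inv_conj,
      invParity_eq_zero_of_mem_minReps cs hm h, add_zero]
  · have e : (v * m)⁻¹ * t * (v * m)⁻¹⁻¹ = r := by rw [hr, inv_inv]
    simp only [overlay, faceSign, chamberSign, hmem, h, if_false, Option.some_or]
    rw [← mul_assoc, mul_inv_rev, invParity_mul, e,
      invParity_eq_zero_of_notMem_parabolic cs (inv_mem hu) h, add_zero]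

/-! ### Right multiplication by `x_K` -/

/-- Right multiplication by `|W_K| x_K` on `ℚW`. -/
noncomputable def mulRepsEnd [Fintype W] (cs : CoxeterSystem M W) (K : Set B) :
    Module.End ℚ (W →₀ ℚ) :=
  (Fintype.card (parabolic cs K) : ℚ) •
    ∑ m : minReps cs K, Finsupp.lmapDomain ℚ ℚ (fun v : W => v * m)

theorem lmapDomain_chamberSign_comp_mulRepsEnd [Fintype W] (cs : CoxeterSystem M W) (K : Set B) :
    Finsupp.lmapDomain ℚ ℚ (chamberSign cs) ∘ₗ mulRepsEnd cs K =
      (∑ g : W, overlayEnd (faceSign cs K g)) ∘ₗ Finsupp.lmapDomain ℚ ℚ (chamberSign cs) := by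
  ext1 v
  ext1
  have key := sum_minReps_parabolic cs K fun g =>
    Finsupp.single (overlay (faceSign cs K (v * g)) (chamberSign cs v)) (1 : ℚ)
  rw [Fintype.sum_congr _ _ fun m : minReps cs K => Fintype.sum_congr _ _ fun u : parabolic cs K =>
    congrArg (fun σ => Finsupp.single σ (1 : ℚ))
      (overlay_faceSign_chamberSign cs v m.2 u.2)] at key
  replace key := key.trans (Equiv.sum_comp (Equiv.mulLeft v) fun g =>
    Finsupp.single (overlay (faceSign cs K g) (chamberSign cs v)) (1 : ℚ))
  simp only [Finset.sum_const, Finset.card_univ, ← Finset.smul_sum] at key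
  simp only [LinearMap.comp_apply, Finsupp.lsingle_apply, mulRepsEnd, LinearMap.smul_apply,
    LinearMap.sum_apply, map_smul, map_sum]
  simp only [Finsupp.lmapDomain_apply, Finsupp.mapDomain_single, overlayEnd_single,
    Nat.cast_smul_eq_nsmul]
  exact key

theorem ConjSubsets.exists_mem_parabolic_iff {cs : CoxeterSystem M W} {I J : Set B}
    (h : ConjSubsets cs I J) :
    ∃ x : W, ∀ u, u ∈ parabolic cs J ↔ x⁻¹ * u * x ∈ parabolic cs I := by
  obtain ⟨x, hx⟩ := h
  refine ⟨x, fun u => ?_⟩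
  have : parabolic cs J = (parabolic cs I).map (MulAut.conj x).toMonoidHom := by
    rw [parabolic, parabolic, MonoidHom.map_closure, ← hx]
    rfl
  rw [this, Subgroup.mem_map_equiv, MulAut.conj_symm_apply]

theorem card_parabolic_eq [Fintype W] {cs : CoxeterSystem M W} {I J : Set B} {x : W}
    (hx : ∀ u, u ∈ parabolic cs J ↔ x⁻¹ * u * x ∈ parabolic cs I) :
    Fintype.card (parabolic cs I) = Fintype.card (parabolic cs J) :=
  (Fintype.card_congr ((MulAut.conj x⁻¹).toEquiv.subtypeEquiv fun u => by simp [hx u])).symm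

theorem isNilpotent_mulRepsEnd_sub [Fintype W] {cs : CoxeterSystem M W} {I J : Set B} {x : W}
    (hx : ∀ u, u ∈ parabolic cs J ↔ x⁻¹ * u * x ∈ parabolic cs I) :
    IsNilpotent (mulRepsEnd cs I - mulRepsEnd cs J) := by
  have hnil : IsNilpotent (∑ g : W, (overlayEnd (faceSign cs I (g * x)) -
      overlayEnd (faceSign cs J g))) :=
    isNilpotent_sum_overlayEnd_sub fun g t => by
      rw [faceSign_eq_none_iff, faceSign_eq_none_iff, hx]
      simp [mul_assoc]
  have hE : Finsupp.lmapDomain ℚ ℚ (chamberSign cs) ∘ₗ (mulRepsEnd cs I - mulRepsEnd cs J) =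
      (∑ g : W, (overlayEnd (faceSign cs I (g * x)) - overlayEnd (faceSign cs J g))) ∘ₗ
        Finsupp.lmapDomain ℚ ℚ (chamberSign cs) := by
    have hsum : ∑ g : W, overlayEnd (faceSign cs I (g * x)) =
        ∑ g : W, overlayEnd (faceSign cs I g) :=
      Equiv.sum_comp (Equiv.mulRight x) fun g => overlayEnd (faceSign cs I g)
    rw [Finset.sum_sub_distrib, hsum, LinearMap.comp_sub, LinearMap.sub_comp,
      lmapDomain_chamberSign_comp_mulRepsEnd, lmapDomain_chamberSign_comp_mulRepsEnd]
  obtain ⟨n, hn⟩ := hnil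
  refine ⟨n, LinearMap.ext fun a => Finsupp.mapDomain_injective (chamberSign_injective cs) ?_⟩
  have := Module.End.commute_pow_left_of_commute hE.symm n
  rw [hn] at this
  exact (LinearMap.congr_fun this a).symm

/-! ### Traces -/

theorem trace_lmapDomain {α : Type*} [Fintype α] (f : α → α) :
    LinearMap.trace ℚ _ (Finsupp.lmapDomain ℚ ℚ f) = ∑ v, if f v = v then 1 else 0 := by
  rw [LinearMap.trace_eq_matrix_trace ℚ (Finsupp.basisSingleOne (R := ℚ) (ι := α))]
  simp [Matrix.trace, LinearMap.toMatrix_apply, Finsupp.single_apply]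

theorem trace_lmapDomain_mul_mulRepsEnd [Fintype W] (cs : CoxeterSystem M W) (K : Set B) (p : W) :
    LinearMap.trace ℚ _ (Finsupp.lmapDomain ℚ ℚ (p * ·) * mulRepsEnd cs K) =
      Fintype.card (parabolic cs K) *
        ∑ m : minReps cs K, ∑ v : W, if p * (v * m) = v then 1 else 0 := by
  rw [mulRepsEnd, mul_smul_comm, Finset.mul_sum, map_smul, map_sum, smul_eq_mul]
  congr 1
  refine Finset.sum_congr rfl fun m _ => ?_
  rw [← trace_lmapDomain, Module.End.mul_eq_comp, ← Finsupp.lmapDomain_comp]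
  rfl

theorem sum_minReps_conj_eq [Fintype W] {cs : CoxeterSystem M W} {I J : Set B} {x : W}
    (hx : ∀ u, u ∈ parabolic cs J ↔ x⁻¹ * u * x ∈ parabolic cs I) (p : W) :
    (∑ m : minReps cs I, ∑ v : W, if p * (v * m) = v then (1 : ℚ) else 0) =
      ∑ m : minReps cs J, ∑ v : W, if p * (v * m) = v then 1 else 0 := by
  have hcomm : ∀ K, Commute (Finsupp.lmapDomain ℚ ℚ (p * ·)) (mulRepsEnd cs K) := by
    intro K
    refine Commute.smul_right (Commute.sum_right _ _ _ fun m _ => ?_) _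
    rw [Commute, SemiconjBy, Module.End.mul_eq_comp, Module.End.mul_eq_comp,
      ← Finsupp.lmapDomain_comp, ← Finsupp.lmapDomain_comp]
    congr 1
    funext v
    simp [mul_assoc]
  have h := (LinearMap.isNilpotent_trace_of_isNilpotent
    (((hcomm I).sub_right (hcomm J)).isNilpotent_mul_left (isNilpotent_mulRepsEnd_sub hx))).eq_zero
  rw [mul_sub, map_sub, trace_lmapDomain_mul_mulRepsEnd, trace_lmapDomain_mul_mulRepsEnd,
    card_parabolic_eq hx, sub_eq_zero] at h
  exact mul_left_cancel₀ (Nat.cast_ne_zero.mpr Fintype.card_ne_zero) h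

theorem card_parabolic_mul_indTriv [Fintype W] (cs : CoxeterSystem M W) (K : Set B) (w : W) :
    Fintype.card (parabolic cs K) * indTriv cs K w =
      ∑ v : W, if v * w * v⁻¹ ∈ parabolic cs K then 1 else 0 := by
  have key := sum_minReps_parabolic cs K fun g =>
    if g⁻¹ * w * g ∈ parabolic cs K then (1 : ℚ) else 0
  have hu : ∀ (m : minReps cs K) (u : parabolic cs K),
      ((m : W) * u)⁻¹ * w * (m * u) ∈ parabolic cs K ↔ (m : W)⁻¹ * w * m ∈ parabolic cs K := by
    intro m u
    rw [show ((m : W) * u)⁻¹ * w * (m * u) = (u : W)⁻¹ * ((m : W)⁻¹ * w * m) * u by group,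
      Subgroup.mul_mem_cancel_right _ u.2, Subgroup.mul_mem_cancel_left _ (inv_mem u.2)]
  simp only [hu, Finset.sum_const, Finset.card_univ, nsmul_eq_mul, ← Finset.mul_sum] at key
  rw [← Equiv.sum_comp (Equiv.inv W)]
  simp only [Equiv.inv_apply, inv_inv]
  rw [← key, indTriv]
  congr 1
  rw [Finset.sum_boole, ← Fintype.card_subtype, ← Nat.card_eq_fintype_card]
  exact congrArg _ (Nat.card_congr (Equiv.subtypeSubtypeEquivSubtypeInter _ _).symm)

theorem card_parabolic_mul_indTriv_eq_sum [Fintype W] (cs : CoxeterSystem M W) (K : Set B) (w : W) :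
    Fintype.card (parabolic cs K) * indTriv cs K w =
      ∑ p : parabolic cs K, ∑ v : W, if p * (v * w) = v then 1 else 0 := by
  rw [card_parabolic_mul_indTriv, Finset.sum_comm]
  refine Finset.sum_congr rfl fun v _ => ?_
  have h : ∀ p : parabolic cs K, (p : W) * (v * w) = v ↔ (p : W)⁻¹ = v * w * v⁻¹ := by
    intro p
    rw [eq_mul_inv_iff_mul_eq, inv_mul_eq_iff_eq_mul, eq_comm]
  simp only [h]
  split_ifs with hv
  · rw [Fintype.sum_eq_single ⟨(v * w * v⁻¹)⁻¹, inv_mem hv⟩]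
    · simp
    · intro p hp
      rw [if_neg]
      intro h'
      exact hp (Subtype.ext (inv_eq_iff_eq_inv.mp h'))
  · refine (Finset.sum_eq_zero fun p _ => if_neg fun h' => hv ?_).symm
    exact h' ▸ inv_mem p.2

theorem indTriv_eq_of_conj [Fintype W] {cs : CoxeterSystem M W} {I J : Set B} {x : W}
    (hx : ∀ u, u ∈ parabolic cs J ↔ x⁻¹ * u * x ∈ parabolic cs I) (w : W) :
    indTriv cs J w = indTriv cs I w := by
  refine mul_left_cancel₀ (Nat.cast_ne_zero.mpr (Fintype.card_ne_zero (α := parabolic cs J))) ?_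
  rw [card_parabolic_mul_indTriv, ← card_parabolic_eq hx, card_parabolic_mul_indTriv,
    ← Equiv.sum_comp (Equiv.mulLeft x)]
  simp [hx, mul_assoc]

theorem card_parabolic_mul_sum_indicator [Fintype W] (cs : CoxeterSystem M W) (I K : Set B) :
    Fintype.card (parabolic cs I) * ∑ w : W, (minReps cs K).indicator (indTriv cs I) w =
      ∑ p : parabolic cs I, ∑ m : minReps cs K, ∑ v : W, if p * (v * m) = v then 1 else 0 := by
  rw [Finset.sum_comm, ← Fintype.sum_congr _ _ fun m : minReps cs K =>
    card_parabolic_mul_indTriv_eq_sum cs I m, ← Finset.mul_sum]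
  congr 1
  simp only [Set.indicator_apply]
  rw [← Finset.sum_filter]
  exact Finset.sum_subtype _ (by simp) _

/-- If `I ∼_W J` then `Σ_{w ∈ X_J} 1_{W_I}^W(w) = Σ_{w ∈ X_I} 1_{W_J}^W(w)`,
i.e. `Φ(x_I)(x_J) = Φ(x_J)(x_I)`. -/
theorem statement13 [Fintype W] (cs : CoxeterSystem M W) (I J : Set B)
    (h : ConjSubsets cs I J) :
    ∑ w : W, (minReps cs J).indicator (indTriv cs I) w
      = ∑ w : W, (minReps cs I).indicator (indTriv cs J) w := by
  obtain ⟨x, hx⟩ := h.exists_mem_parabolic_iff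
  rw [funext (indTriv_eq_of_conj hx)]
  refine mul_left_cancel₀ (Nat.cast_ne_zero.mpr (Fintype.card_ne_zero (α := parabolic cs I))) ?_
  rw [card_parabolic_mul_sum_indicator, card_parabolic_mul_sum_indicator]
  exact Finset.sum_congr rfl fun p _ => (sum_minReps_conj_eq hx p).symm
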